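/- With the parameter choices c_min = 0, c_max = 2 and λ = 1 (so c(h) = 2/(1 + exp(h - τ))), the margin-adaptive weight w is Lipschitz continuous on ℝ: there exists a constant L_w > 0 such that |w(h) - w(h')| ≤ L_w·|h - h'| for all h, h' ∈ ℝ. -/

import Mathlib

/-- The logistic sigmoid function. -/
noncomputable def sigma (x : ℝ) : ℝ := 1 / (1 + Real.exp (-x))

/-- The coefficient function with `c_min = 0`, `c_max = 2`, `λ = 1`. -/
noncomputable def coef2 (τ h : ℝ) : ℝ := 2 / (1 + Real.exp (h - τ))

/-- The margin-adaptive weight with `c_min = 0`, `c_max = 2`, `λ = 1`. -/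
noncomputable def madw2 (τ h : ℝ) : ℝ :=
  if h > -τ then sigma (coef2 τ |h| * h) / sigma h else 1

lemma sigma_pos (x : ℝ) : 0 < sigma x := by
  unfold sigma
  positivity

lemma sigma_le_one (x : ℝ) : sigma x ≤ 1 := by
  unfold sigma
  rw [div_le_one (by positivity)]
  linarith [Real.exp_pos (-x)]

lemma abs_sigma_sub_le (a b : ℝ) : |sigma a - sigma b| ≤ |a - b| := by
  have hderiv (x : ℝ) :
      HasDerivAt sigma (Real.exp (-x) / (1 + Real.exp (-x)) ^ 2) x := by
    have h := ((hasDerivAt_neg x).exp.const_add 1).inv (by positivity)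
    refine (h.congr_deriv (by ring)).congr_of_eventuallyEq (.of_forall fun y => ?_)
    simp [sigma]
  have h := Convex.norm_image_sub_le_of_norm_hasDerivWithin_le (C := 1)
    (fun x _ => (hderiv x).hasDerivWithinAt) (fun x _ => ?_) convex_univ
    (Set.mem_univ b) (Set.mem_univ a)
  · simpa using h
  · have := Real.exp_pos (-x)
    rw [Real.norm_of_nonneg (by positivity), div_le_one (by positivity)]
    nlinarith

lemma abs_exp_neg_sub_le {c a b : ℝ} (ha : c ≤ a) (hb : c ≤ b) :
    |Real.exp (-a) - Real.exp (-b)| ≤ Real.exp (-c) * |a - b| := by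
  refine Convex.norm_image_sub_le_of_norm_hasDerivWithin_le (s := Set.Ici c)
    (f := fun x => Real.exp (-x)) (f' := fun x => -Real.exp (-x)) (fun x _ => ?_)
    (fun x hx => ?_) (convex_Ici c) hb ha
  · simpa using (hasDerivAt_id x).neg.exp.hasDerivWithinAt
  · simpa using hx

lemma abs_coef2_mul_self_sub_le (τ : ℝ) {a b : ℝ} (ha : 0 ≤ a) (hb : 0 ≤ b) :
    |coef2 τ a * a - coef2 τ b * b| ≤ (2 + 2 * Real.exp τ) * |a - b| := by
  refine Convex.norm_image_sub_le_of_norm_hasDerivWithin_le (s := Set.Ici (0 : ℝ))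
    (f := fun x => coef2 τ x * x)
    (f' := fun x => 2 / (1 + Real.exp (x - τ)) -
      2 * (x * Real.exp (x - τ)) / (1 + Real.exp (x - τ)) ^ 2) (fun x _ => ?_)
    (fun x hx => ?_) (convex_Ici 0) hb ha
  · have hne : 1 + Real.exp (x - τ) ≠ 0 := by positivity
    have h := ((((((hasDerivAt_id x).sub_const τ).exp.const_add 1).inv hne).const_mul 2).mul
      (hasDerivAt_id x)).hasDerivWithinAt (s := Set.Ici (0 : ℝ))
    refine (h.congr_deriv ?_).congr (fun y _ => ?_) ?_
    · simp only [id, Pi.inv_apply]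
      field_simp
      ring
    · simp [coef2, div_eq_mul_inv]
    · simp [coef2, div_eq_mul_inv]
  · have hx0 : 0 ≤ x := hx
    have hE := Real.exp_pos (x - τ)
    have hxE : x ≤ Real.exp τ * Real.exp (x - τ) := by
      rw [← Real.exp_add, add_sub_cancel]
      linarith [Real.add_one_le_exp x]
    have h1 : 2 / (1 + Real.exp (x - τ)) ≤ 2 := by
      rw [div_le_iff₀ (by positivity)]
      linarith
    have h2 : 2 * (x * Real.exp (x - τ)) / (1 + Real.exp (x - τ)) ^ 2 ≤ 2 * Real.exp τ := by
      rw [div_le_iff₀ (by positivity)]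
      have := mul_le_mul_of_nonneg_right hxE hE.le
      nlinarith [mul_pos (Real.exp_pos τ) hE, Real.exp_pos τ]
    have h3 : 0 ≤ 2 / (1 + Real.exp (x - τ)) := by positivity
    have h4 : 0 ≤ 2 * (x * Real.exp (x - τ)) / (1 + Real.exp (x - τ)) ^ 2 := by positivity
    rw [Real.norm_eq_abs, abs_le]
    constructor <;> linarith [Real.exp_pos τ]

lemma coef2_abs_mul_self_eq (τ h : ℝ) :
    coef2 τ |h| * h =
      coef2 τ (max h 0) * max h 0 - coef2 τ (max (-h) 0) * max (-h) 0 := by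
  rcases le_total 0 h with hh | hh
  · simp [abs_of_nonneg hh, hh]
  · simp [abs_of_nonpos hh, hh]

lemma abs_coef2_abs_mul_self_sub_le (τ a b : ℝ) :
    |coef2 τ |a| * a - coef2 τ |b| * b| ≤ (4 + 4 * Real.exp τ) * |a - b| := by
  have h1 := abs_coef2_mul_self_sub_le τ (le_max_right a 0) (le_max_right b 0)
  have h2 := abs_coef2_mul_self_sub_le τ (le_max_right (-a) 0) (le_max_right (-b) 0)
  have h3 := abs_max_sub_max_le_abs a b 0
  have h4 : |max (-a) 0 - max (-b) 0| ≤ |a - b| := by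
    refine (abs_max_sub_max_le_abs (-a) (-b) 0).trans_eq ?_
    rw [neg_sub_neg, abs_sub_comm]
  have hK : 0 ≤ 2 + 2 * Real.exp τ := by positivity
  have h5 := mul_le_mul_of_nonneg_left h3 hK
  have h6 := mul_le_mul_of_nonneg_left h4 hK
  rw [coef2_abs_mul_self_eq τ a, coef2_abs_mul_self_eq τ b, sub_sub_sub_comm]
  refine (abs_sub _ _).trans ?_
  linarith

lemma madw2_eq {τ : ℝ} (hτ : 0 < τ) (h : ℝ) :
    madw2 τ h =
      sigma (coef2 τ |max h (-τ)| * max h (-τ)) * (1 + Real.exp (-max h (-τ))) := by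
  unfold madw2
  split_ifs with hh
  · rw [max_eq_left hh.le]
    simp [sigma, div_eq_mul_inv]
  · rw [max_eq_right (not_lt.mp hh), abs_neg, abs_of_pos hτ]
    have : 1 + Real.exp τ ≠ 0 := by positivity
    norm_num [coef2, sigma, this]

/-- With `c_min = 0`, `c_max = 2`, `λ = 1`, the margin-adaptive weight `w` is
Lipschitz continuous on `ℝ`. -/
theorem madw2_lipschitz (τ : ℝ) (hτ : 0 < τ) :
    ∃ L : ℝ, 0 < L ∧ ∀ h h' : ℝ, |madw2 τ h - madw2 τ h'| ≤ L * |h - h'| := by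
  refine ⟨(4 + 4 * Real.exp τ) * (1 + Real.exp τ) + Real.exp τ, by positivity, fun h h' => ?_⟩
  rw [madw2_eq hτ, madw2_eq hτ]
  have hmax := abs_max_sub_max_le_abs h h' (-τ)
  have ha := le_max_right h (-τ)
  have hb := le_max_right h' (-τ)
  generalize max h (-τ) = a at *
  generalize max h' (-τ) = b at *
  have hexp := abs_exp_neg_sub_le ha hb
  rw [neg_neg] at hexp
  have hsigma := (abs_sigma_sub_le _ _).trans (abs_coef2_abs_mul_self_sub_le τ a b)
  have hbound : |1 + Real.exp (-a)| ≤ 1 + Real.exp τ := by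
    rw [abs_of_pos (by positivity)]
    gcongr
    linarith
  have hone : |sigma (coef2 τ |b| * b)| ≤ 1 := by
    rw [abs_of_pos (sigma_pos _)]
    exact sigma_le_one _
  generalize sigma (coef2 τ |a| * a) = s at *
  generalize sigma (coef2 τ |b| * b) = t at *
  calc |s * (1 + Real.exp (-a)) - t * (1 + Real.exp (-b))|
      = |(s - t) * (1 + Real.exp (-a)) + t * (Real.exp (-a) - Real.exp (-b))| := by
        congr 1
        ring
    _ ≤ |s - t| * |1 + Real.exp (-a)| + |t| * |Real.exp (-a) - Real.exp (-b)| := by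
        rw [← abs_mul, ← abs_mul]
        exact abs_add_le _ _
    _ ≤ (4 + 4 * Real.exp τ) * |a - b| * (1 + Real.exp τ) + 1 * (Real.exp τ * |a - b|) := by
        gcongr
    _ = ((4 + 4 * Real.exp τ) * (1 + Real.exp τ) + Real.exp τ) * |a - b| := by ring
    _ ≤ _ := by gcongr
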